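/- For each t ∈ F let m_t be the supercommutative superalgebra structure on J determined by m_t(e₁,e₁) = e₁, m_t(e₁,e₂) = e₂, m_t(e₂,e₂) = t·e₂, m_t(e₁,fⱼ) = fⱼ, m_t(e₂,fⱼ) = (t/2)·fⱼ for j ∈ {1,2}, and m_t(f₁,f₂) = e₁ + e₂. Then: (i) m₀ is the multiplication of the superalgebra (2,2)₄₃; and (ii) for every t with t ≠ 0 and t ≠ −1, the F-linear map φ with φ(e₁) = e₁ + e₂, φ(e₂) = t·e₂, φ(f₁) = f₁, φ(f₂) = f₂ is a graded algebra isomorphism from (J, m_t) onto D_{1+t}. Hence the family (m_t) is a one-parameter degeneration of the family D_γ to (2,2)₄₃. -/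

import Mathlib

namespace JS22

variable (F : Type*) [Field F] [CharZero F]

/-- The underlying ℤ₂-graded vector space `J = F⁴`: coordinates `0,1` are the even
basis vectors `e₁, e₂` and coordinates `2,3` are the odd basis vectors `f₁, f₂`. -/
abbrev J : Type _ := Fin 4 → F

def e1 : J F := ![1, 0, 0, 0]
def e2 : J F := ![0, 1, 0, 0]
def f1 : J F := ![0, 0, 1, 0]
def f2 : J F := ![0, 0, 0, 1]

/-- The even part `J₀ = span {e₁, e₂}`. -/
def J0 : Submodule F (J F) := Submodule.span F {e1 F, e2 F}

/-- The odd part `J₁ = span {f₁, f₂}`. -/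
def J1 : Submodule F (J F) := Submodule.span F {f1 F, f2 F}

/-- `x` is homogeneous of degree `d ∈ {0, 1}`. -/
def IsHomog (x : J F) (d : ℕ) : Prop :=
  (d = 0 ∧ x ∈ J0 F) ∨ (d = 1 ∧ x ∈ J1 F)

/-- A (bilinear) multiplication is supercommutative: `x y = (−1)^{|x||y|} y x`. -/
def IsSuperComm (mul : J F → J F → J F) : Prop :=
  ∀ x y : J F, ∀ dx dy : ℕ, IsHomog F x dx → IsHomog F y dy →
    mul x y = ((-1 : F) ^ (dx * dy)) • mul y x

/-- The Jordan superidentity, for all homogeneous `w, x, y, z`. -/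
def SatisfiesJordanSuperId (mul : J F → J F → J F) : Prop :=
  ∀ w x y z : J F, ∀ dw dx dy dz : ℕ,
    IsHomog F w dw → IsHomog F x dx → IsHomog F y dy → IsHomog F z dz →
    mul (mul w x) (mul y z)
      + ((-1 : F) ^ (dx * dy)) • mul (mul w y) (mul x z)
      + ((-1 : F) ^ ((dx + dy) * dz)) • mul (mul w z) (mul x y)
      - ((-1 : F) ^ (dw * dx)) • mul x (mul w (mul y z))
      - ((-1 : F) ^ (dy * (dw + dx))) • mul y (mul w (mul x z))
      - ((-1 : F) ^ (dz * (dw + dx + dy))) • mul z (mul w (mul x y)) = 0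

/-- `F(a,b,c,d) = h((ab)c, d) + h(ab,c)·d + (h(a,b)·c)·d`. -/
def Fc (mul : J F → J F → J F) (h : J F →ₗ[F] J F →ₗ[F] J F) (a b c d : J F) : J F :=
  h (mul (mul a b) c) d + mul (h (mul a b) c) d + mul (mul (h a b) c) d

/-- `G(a,b,c,d) = h(ab, cd) + h(a,b)·(cd) + (ab)·h(c,d)`. -/
def Gc (mul : J F → J F → J F) (h : J F →ₗ[F] J F →ₗ[F] J F) (a b c d : J F) : J F :=
  h (mul a b) (mul c d) + mul (h a b) (mul c d) + mul (mul a b) (h c d)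

/-- Supersymmetry of `h`: `h(a,b) = (−1)^{|a||b|} h(b,a)` for homogeneous `a, b`. -/
def IsSuperSym (h : J F →ₗ[F] J F →ₗ[F] J F) : Prop :=
  ∀ a b : J F, ∀ da db : ℕ, IsHomog F a da → IsHomog F b db →
    h a b = ((-1 : F) ^ (da * db)) • h b a

/-- The 2-cocycle identity for `h` with respect to the multiplication `mul`. -/
def IsCocycleId (mul : J F → J F → J F) (h : J F →ₗ[F] J F →ₗ[F] J F) : Prop :=
  ∀ a b c d : J F, ∀ da db dc dd : ℕ,
    IsHomog F a da → IsHomog F b db → IsHomog F c dc → IsHomog F d dd →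
    Fc F mul h a b c d + ((-1 : F) ^ (db * (dc + dd) + dc * dd)) • Fc F mul h a d c b
      + ((-1 : F) ^ (da * (db + dc + dd) + dc * dd)) • Fc F mul h b d c a
    = Gc F mul h a b c d + ((-1 : F) ^ (db * dc)) • Gc F mul h a c b d
      + ((-1 : F) ^ (dd * (dc + db))) • Gc F mul h a d b c

/-- `h` is a supersymmetric 2-cocycle. -/
def IsSuperCocycle (mul : J F → J F → J F) (h : J F →ₗ[F] J F →ₗ[F] J F) : Prop :=
  IsSuperSym F h ∧ IsCocycleId F mul h

/-- `h` is a coboundary: `h(a,b) = a·μ(b) + μ(a)·b − μ(a·b)` for some linear `μ`. -/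
def IsCoboundary (mul : J F → J F → J F) (h : J F →ₗ[F] J F →ₗ[F] J F) : Prop :=
  ∃ μ : J F →ₗ[F] J F, ∀ a b : J F, h a b = mul a (μ b) + mul (μ a) b - μ (mul a b)

/-- The bilinear map `h` is even: `h(J_i × J_j) ⊆ J_{i+j}`. -/
def IsEvenBilin (h : J F →ₗ[F] J F →ₗ[F] J F) : Prop :=
  (∀ a ∈ J0 F, ∀ b ∈ J0 F, h a b ∈ J0 F) ∧
  (∀ a ∈ J0 F, ∀ b ∈ J1 F, h a b ∈ J1 F) ∧
  (∀ a ∈ J1 F, ∀ b ∈ J0 F, h a b ∈ J1 F) ∧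
  (∀ a ∈ J1 F, ∀ b ∈ J1 F, h a b ∈ J0 F)

/-- The linear map `μ` is even: `μ(J_i) ⊆ J_i`. -/
def IsEvenLin (μ : J F →ₗ[F] J F) : Prop :=
  (∀ a ∈ J0 F, μ a ∈ J0 F) ∧ (∀ a ∈ J1 F, μ a ∈ J1 F)

/-- `φ` is a graded algebra isomorphism from `(J, mulA)` onto `(J, mulB)`. -/
def IsGradedIso (mulA mulB : J F → J F → J F) (φ : J F → J F) : Prop :=
  IsLinearMap F φ ∧ Function.Bijective φ ∧
  φ '' (J0 F : Set (J F)) = (J0 F : Set (J F)) ∧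
  φ '' (J1 F : Set (J F)) = (J1 F : Set (J F)) ∧
  ∀ x y : J F, φ (mulA x y) = mulB (φ x) (φ y)

/-- `D_γ`: `e₁²=e₁`, `e₂²=e₂`, `eᵢfⱼ = ½fⱼ`, `f₁f₂ = e₁ + γe₂`. -/
def mulD (γ : F) (x y : J F) : J F :=
  ![x 0 * y 0 + (x 2 * y 3 - x 3 * y 2),
    x 1 * y 1 + γ * (x 2 * y 3 - x 3 * y 2),
    ((x 0 + x 1) * y 2 + x 2 * (y 0 + y 1)) / 2,
    ((x 0 + x 1) * y 3 + x 3 * (y 0 + y 1)) / 2]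

/-- `(2,2)₁`: `e₁²=e₁`, `e₂²=e₂`. -/
def mul1 (x y : J F) : J F :=
  ![x 0 * y 0, x 1 * y 1, 0, 0]

/-- `(2,2)₃`: `e₁²=e₁`, `e₂²=e₂`, `e₁f₁=½f₁`, `e₁f₂=½f₂`, `f₁f₂=e₁`. -/
def mul3 (x y : J F) : J F :=
  ![x 0 * y 0 + (x 2 * y 3 - x 3 * y 2), x 1 * y 1,
    (x 0 * y 2 + x 2 * y 0) / 2, (x 0 * y 3 + x 3 * y 0) / 2]

/-- `(2,2)₅`: `e₁²=e₁`, `e₂²=e₂`, `e₁f₁=f₁`, `e₁f₂=f₂`, `f₁f₂=e₁`. -/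
def mul5 (x y : J F) : J F :=
  ![x 0 * y 0 + (x 2 * y 3 - x 3 * y 2), x 1 * y 1,
    x 0 * y 2 + x 2 * y 0, x 0 * y 3 + x 3 * y 0]

/-- `(2,2)₇`: `e₁²=e₁`, `e₂²=e₂`, `eᵢfⱼ=½fⱼ`, `f₁f₂=e₂`. -/
def mul7 (x y : J F) : J F :=
  ![x 0 * y 0, x 1 * y 1 + (x 2 * y 3 - x 3 * y 2),
    ((x 0 + x 1) * y 2 + x 2 * (y 0 + y 1)) / 2,
    ((x 0 + x 1) * y 3 + x 3 * (y 0 + y 1)) / 2]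

/-- `(2,2)₈`: `e₁²=e₁`, `e₂²=e₂`, `e₁f₁=½f₁`. -/
def mul8 (x y : J F) : J F :=
  ![x 0 * y 0, x 1 * y 1, (x 0 * y 2 + x 2 * y 0) / 2, 0]

/-- `(2,2)₂₆`: `e₁²=e₁`, `e₁f₁=½f₁`, `e₁f₂=½f₂`, `f₁f₂=e₁+e₂`. -/
def mul26 (x y : J F) : J F :=
  ![x 0 * y 0 + (x 2 * y 3 - x 3 * y 2), x 2 * y 3 - x 3 * y 2,
    (x 0 * y 2 + x 2 * y 0) / 2, (x 0 * y 3 + x 3 * y 0) / 2]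

/-- `(2,2)₄₃`: `e₁²=e₁`, `e₁e₂=e₂`, `e₁f₁=f₁`, `e₁f₂=f₂`, `f₁f₂=e₁+e₂`. -/
def mul43 (x y : J F) : J F :=
  ![x 0 * y 0 + (x 2 * y 3 - x 3 * y 2),
    x 0 * y 1 + x 1 * y 0 + (x 2 * y 3 - x 3 * y 2),
    x 0 * y 2 + x 2 * y 0, x 0 * y 3 + x 3 * y 0]

/-- `(2,2)₅₂`: `e₁²=e₁`, `e₁e₂=½e₂`. -/
def mul52 (x y : J F) : J F :=
  ![x 0 * y 0, (x 0 * y 1 + x 1 * y 0) / 2, 0, 0]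

/-- `(2,2)₅₇`: `e₁²=e₁`, `e₁e₂=½e₂`, `e₁f₂=f₂`. -/
def mul57 (x y : J F) : J F :=
  ![x 0 * y 0, (x 0 * y 1 + x 1 * y 0) / 2, 0, x 0 * y 3 + x 3 * y 0]

/-- `(2,2)₆₀`: `e₁²=e₁`, `e₁e₂=½e₂`, `e₁f₁=½f₁`, `e₁f₂=½f₂`. -/
def mul60 (x y : J F) : J F :=
  ![x 0 * y 0, (x 0 * y 1 + x 1 * y 0) / 2,
    (x 0 * y 2 + x 2 * y 0) / 2, (x 0 * y 3 + x 3 * y 0) / 2]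

/-- `(2,2)₆₇`: `e₁²=e₁`, `e₁e₂=½e₂`, `e₁f₁=f₁`, `e₁f₂=f₂`. -/
def mul67 (x y : J F) : J F :=
  ![x 0 * y 0, (x 0 * y 1 + x 1 * y 0) / 2,
    x 0 * y 2 + x 2 * y 0, x 0 * y 3 + x 3 * y 0]


/-- The family `m_t`: `e₁²=e₁`, `e₁e₂=e₂`, `e₂²=t·e₂`, `e₁fⱼ=fⱼ`, `e₂fⱼ=(t/2)fⱼ`,
`f₁f₂ = e₁ + e₂`. -/
def mt14 (t : F) (x y : J F) : J F :=
  ![x 0 * y 0 + (x 2 * y 3 - x 3 * y 2),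
    x 0 * y 1 + x 1 * y 0 + t * (x 1 * y 1) + (x 2 * y 3 - x 3 * y 2),
    x 0 * y 2 + x 2 * y 0 + t * (x 1 * y 2 + x 2 * y 1) / 2,
    x 0 * y 3 + x 3 * y 0 + t * (x 1 * y 3 + x 3 * y 1) / 2]

/-- The linear map `φ`: `e₁ ↦ e₁ + e₂`, `e₂ ↦ t·e₂`, `f₁ ↦ f₁`, `f₂ ↦ f₂`. -/
def phi14 (t : F) (x : J F) : J F := ![x 0, x 0 + t * x 1, x 2, x 3]

theorem mem_J0_iff (x : J F) : x ∈ J0 F ↔ x 2 = 0 ∧ x 3 = 0 := by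
  unfold J0
  rw [Submodule.mem_span_pair]
  constructor
  · rintro ⟨a, b, rfl⟩
    simp [e1, e2]
  · rintro ⟨h2, h3⟩
    refine ⟨x 0, x 1, ?_⟩
    ext i
    fin_cases i <;> simp [e1, e2, h2, h3]

theorem mem_J1_iff (x : J F) : x ∈ J1 F ↔ x 0 = 0 ∧ x 1 = 0 := by
  unfold J1
  rw [Submodule.mem_span_pair]
  constructor
  · rintro ⟨a, b, rfl⟩
    simp [f1, f2]
  · rintro ⟨h2, h3⟩
    refine ⟨x 2, x 3, ?_⟩
    ext i
    fin_cases i <;> simp [f1, f2, h2, h3]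

theorem phi14_inv (t : F) (ht : t ≠ 0) (y : J F) :
    phi14 F t ![y 0, (y 1 - y 0) / t, y 2, y 3] = y := by
  ext i
  fin_cases i <;> simp [phi14]
  field_simp
  ring

/-- the family `m_t` is supercommutative, `m₀` is the multiplication of
`(2,2)₄₃`, and for `t ≠ 0`, `t ≠ −1` the map `φ` is a graded algebra isomorphism from
`(J, m_t)` onto `D_{1+t}`; hence `(m_t)` is a one-parameter degeneration of the family
`D_γ` to `(2,2)₄₃`. -/
theorem degeneration_D_to_alg43 :
    (∀ t : F, IsSuperComm F (mt14 F t)) ∧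
    mt14 F 0 = mul43 F ∧
    (∀ t : F, t ≠ 0 → t ≠ -1 →
      IsGradedIso F (mt14 F t) (mulD F (1 + t)) (phi14 F t)) := by
  refine ⟨?_, ?_, ?_⟩
  · intro t x y dx dy hx hy
    rcases hx with ⟨rfl, hx⟩ | ⟨rfl, hx⟩ <;> rcases hy with ⟨rfl, hy⟩ | ⟨rfl, hy⟩ <;>
      simp only [mem_J0_iff, mem_J1_iff] at hx hy <;>
      obtain ⟨hx1, hx2⟩ := hx <;> obtain ⟨hy1, hy2⟩ := hy <;>
      ext i <;> fin_cases i <;> simp [mt14, hx1, hx2, hy1, hy2] <;> ring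
  · funext x y
    simp [mt14, mul43]
  · intro t ht _
    refine ⟨⟨?_, ?_⟩, ⟨?_, ?_⟩, ?_, ?_, ?_⟩
    · intro x y
      ext i
      fin_cases i <;> simp [phi14]
      ring
    · intro c x
      ext i
      fin_cases i <;> simp [phi14]
      ring
    · intro x y h
      have h0 : x 0 = y 0 := by simpa [phi14] using congrFun h 0
      have h1 : x 1 = y 1 := by simpa [phi14, h0, ht] using congrFun h 1
      have h2 : x 2 = y 2 := by simpa [phi14] using congrFun h 2
      have h3 : x 3 = y 3 := by simpa [phi14] using congrFun h 3
      ext i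
      fin_cases i <;> assumption
    · intro y
      exact ⟨_, phi14_inv F t ht y⟩
    · ext y
      simp only [Set.mem_image, SetLike.mem_coe, mem_J0_iff]
      constructor
      · rintro ⟨x, hx, rfl⟩
        simpa [phi14] using hx
      · intro hy
        exact ⟨_, by simpa using hy, phi14_inv F t ht y⟩
    · ext y
      simp only [Set.mem_image, SetLike.mem_coe, mem_J1_iff]
      constructor
      · rintro ⟨x, ⟨h0, h1⟩, rfl⟩
        simp [phi14, h0, h1]
      · rintro ⟨h0, h1⟩
        exact ⟨_, by simp [h0, h1], phi14_inv F t ht y⟩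
    · intro x y
      ext i
      fin_cases i <;> simp [phi14, mt14, mulD] <;> ring

end JS22
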